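/- arXiv:1805.07503 — 2 statements merged into one kernel-verified Lean document; each statement's English description precedes it below -/
import Mathlib

section
/- Let X be a compact metric space and let f_n : X → X be a sequence of continuous nonwandering maps converging uniformly to a map f : X → X. If the sequence (f_n) has the uniform shadowing property, then f is nonwandering. -/
open Filter Topology Set
open scoped ENNReal

variable {X : Type*}

/-- A sequence `(x i)` is a `δ`-pseudo-orbit for `f` if `dist (f (x i)) (x (i+1)) < δ`
for every `i ≥ 0`. -/
def IsPseudoOrbit [MetricSpace X] (f : X → X) (δ : ℝ) (x : ℕ → X) : Prop :=
  ∀ i : ℕ, dist (f (x i)) (x (i + 1)) < δ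

/-- A sequence `(x i)` is `ε`-shadowed by the point `y`. -/
def IsShadowedBy [MetricSpace X] (f : X → X) (ε : ℝ) (x : ℕ → X) (y : X) : Prop :=
  ∀ i : ℕ, dist (f^[i] y) (x i) < ε

/-- A point `x₀` is shadowable: for every `ε > 0` there is `δ > 0` such that every
`δ`-pseudo-orbit starting at `x₀` is `ε`-shadowed by some point. -/
def ShadowablePoint [MetricSpace X] (f : X → X) (x₀ : X) : Prop :=
  ∀ ε > (0 : ℝ), ∃ δ > (0 : ℝ), ∀ x : ℕ → X, IsPseudoOrbit f δ x → x 0 = x₀ →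
    ∃ y : X, IsShadowedBy f ε x y

/-- `f` has the shadowing property. -/
def ShadowingProperty [MetricSpace X] (f : X → X) : Prop :=
  ∀ ε > (0 : ℝ), ∃ δ > (0 : ℝ), ∀ x : ℕ → X, IsPseudoOrbit f δ x →
    ∃ y : X, IsShadowedBy f ε x y

/-- A sequence of maps `F n` has the uniform shadowing property: each `F n` has the shadowing
property and, for every `ε > 0`, one single `δ > 0` works for all the maps `F n`. -/
def UniformShadowing [MetricSpace X] (F : ℕ → X → X) : Prop :=
  (∀ n, ShadowingProperty (F n)) ∧
    ∀ ε > (0 : ℝ), ∃ δ > (0 : ℝ), ∀ n, ∀ x : ℕ → X, IsPseudoOrbit (F n) δ x →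
      ∃ y : X, IsShadowedBy (F n) ε x y

/-- A point `x` is nonwandering for `f` if every neighborhood `U` of `x` satisfies
`f^n(U) ∩ U ≠ ∅` for some `n ≥ 1`. -/
def NonwanderingPt [MetricSpace X] (f : X → X) (x : X) : Prop :=
  ∀ U ∈ 𝓝 x, ∃ n : ℕ, 1 ≤ n ∧ (f^[n] '' U ∩ U).Nonempty

/-- `s_n(V, ε)`: the maximal cardinality of an `(n, ε)`-separated subset of `V`. -/
noncomputable def sepNum [MetricSpace X] (f : X → X) (V : Set X) (n : ℕ) (ε : ℝ) : ℕ :=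
  sSup {k : ℕ | ∃ E : Finset X, ↑E ⊆ V ∧ E.card = k ∧
    ∀ x ∈ E, ∀ y ∈ E, x ≠ y → ∃ i ≤ n, ε ≤ dist (f^[i] x) (f^[i] y)}

/-- `lim_{ε → 0} limsup_{n → ∞} (1/n) log s_n(V, ε)`, as a supremum over `ε > 0`
(the inner quantity is monotone as `ε` decreases). -/
noncomputable def entropyWithin [MetricSpace X] (f : X → X) (V : Set X) : ℝ≥0∞ :=
  ⨆ (ε : ℝ) (_ : 0 < ε),
    Filter.limsup (fun n : ℕ => ENNReal.ofReal (Real.log (sepNum f V n ε) / n)) Filter.atTop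

/-- The topological entropy of `f`. -/
noncomputable def topEntropy [MetricSpace X] (f : X → X) : ℝ≥0∞ :=
  entropyWithin f Set.univ

/-- Iterates of a uniformly convergent sequence converge uniformly to the iterates of the limit,
if the limit is uniformly continuous. -/
theorem tendstoUniformly_iterate [MetricSpace X] {F : ℕ → X → X} {f : X → X}
    (hf : UniformContinuous f) (hF : TendstoUniformly F f atTop) (k : ℕ) :
    TendstoUniformly (fun m => (F m)^[k]) f^[k] atTop := by
  induction k with
  | zero =>
    rw [Metric.tendstoUniformly_iff]
    intro ε hε
    simp [hε]
  | succ k ih =>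
    rw [Metric.tendstoUniformly_iff] at *
    intro ε hε
    obtain ⟨η, hη, hfη⟩ := Metric.uniformContinuous_iff.1 hf (ε / 2) (half_pos hε)
    filter_upwards [ih η hη, hF (ε / 2) (half_pos hε)] with m hm hm' x
    rw [Function.iterate_succ_apply', Function.iterate_succ_apply']
    calc dist (f (f^[k] x)) (F m ((F m)^[k] x))
        ≤ dist (f (f^[k] x)) (f ((F m)^[k] x)) +
            dist (f ((F m)^[k] x)) (F m ((F m)^[k] x)) := dist_triangle _ _ _
      _ < ε / 2 + ε / 2 := add_lt_add (hfη (hm x)) (hm' _)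
      _ = ε := add_halves ε

/-- Repeating a finite orbit segment that nearly returns to its start gives a pseudo-orbit. -/
theorem isPseudoOrbit_iterate_mod [MetricSpace X] {g : X → X} {δ : ℝ} {k : ℕ} {y : X}
    (hδ : 0 < δ) (hk : 1 ≤ k) (hy : dist (g^[k] y) y < δ) :
    IsPseudoOrbit g δ (fun i => g^[i % k] y) := by
  intro i
  have hlt : i % k < k := Nat.mod_lt i hk
  simp only [← Function.iterate_succ_apply' g, Nat.succ_eq_add_one]
  rcases Nat.lt_or_ge (i % k + 1) k with h | h
  · have hmod : (i + 1) % k = i % k + 1 := by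
      rw [← Nat.mod_add_mod, Nat.mod_eq_of_lt h]
    simpa [hmod] using hδ
  · have heq : i % k + 1 = k := by omega
    have hmod : (i + 1) % k = 0 := by
      rw [← Nat.mod_add_mod, heq, Nat.mod_self]
    simpa [hmod, heq] using hy

/-- A pseudo-orbit for `f` is a pseudo-orbit, with a larger error, for any map close to `f`. -/
theorem IsPseudoOrbit.of_dist_lt [MetricSpace X] {f g : X → X} {δ η : ℝ} {x : ℕ → X}
    (hx : IsPseudoOrbit f δ x) (hfg : ∀ z, dist (f z) (g z) < η) :
    IsPseudoOrbit g (η + δ) x := fun i =>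
  calc dist (g (x i)) (x (i + 1))
      ≤ dist (f (x i)) (g (x i)) + dist (f (x i)) (x (i + 1)) := dist_triangle_left _ _ _
    _ < η + δ := add_lt_add (hfg _) (hx i)

/-- Lemma: the uniform limit of a sequence of nonwandering maps with the uniform shadowing
property is nonwandering. -/
theorem stmt10 [MetricSpace X] [CompactSpace X]
    (F : ℕ → X → X) (hc : ∀ n, Continuous (F n))
    (hnw : ∀ n, ∀ x : X, NonwanderingPt (F n) x)
    (f : X → X) (hconv : TendstoUniformly F f atTop)
    (hus : UniformShadowing F) :
    ∀ x : X, NonwanderingPt f x := by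
  intro x U hU
  obtain ⟨ε, hε, hεU⟩ := Metric.mem_nhds_iff.1 hU
  have hf : UniformContinuous f :=
    CompactSpace.uniformContinuous_of_continuous
      (hconv.continuous (Frequently.of_forall hc))
  obtain ⟨δ, hδ, hshadow⟩ := hus.2 (ε / 3) (by positivity)
  have hclose := Metric.tendstoUniformly_iff.1 hconv (δ / 4) (by positivity)
  obtain ⟨n, hn⟩ := hclose.exists
  -- an orbit segment of `F n` which starts near `x` and nearly returns to its start
  obtain ⟨k, hk, -, ⟨y, hy, rfl⟩, hky⟩ := hnw n x (Metric.ball x (min (ε / 3) (δ / 4)))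
    (Metric.ball_mem_nhds x (by positivity))
  rw [Metric.mem_ball, lt_min_iff] at hy hky
  have hret : dist ((F n)^[k] y) y < δ / 2 := by
    linarith [dist_triangle_right ((F n)^[k] y) y x]
  have hp := isPseudoOrbit_iterate_mod (half_pos hδ) hk hret
  -- a map `F m` close to `f`, and whose `k`-th iterate is close to that of `f`
  obtain ⟨m, hm, hmk⟩ := (hclose.and (Metric.tendstoUniformly_iff.1
    (tendstoUniformly_iterate hf hconv k) (ε / 3) (by positivity))).exists
  have hnm : ∀ z, dist (F n z) (F m z) < δ / 2 := fun z => by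
    linarith [dist_triangle_left (F n z) (F m z) (f z), hn z, hm z]
  have hp' := hp.of_dist_lt hnm
  rw [add_halves] at hp'
  obtain ⟨z, hz⟩ := hshadow m _ hp'
  have hz0 : dist z y < ε / 3 := by simpa using hz 0
  have hzk : dist ((F m)^[k] z) y < ε / 3 := by simpa using hz k
  refine ⟨k, hk, f^[k] z, ⟨z, hεU ?_, rfl⟩, hεU ?_⟩
  · rw [Metric.mem_ball]
    linarith [dist_triangle z y x]
  · rw [Metric.mem_ball]
    linarith [dist_triangle4 (f^[k] z) ((F m)^[k] z) y x, hmk z]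
end

section
/- Let X be a compact metric space and let f_n : X → X be a sequence of continuous topologically mixing maps converging uniformly to a map f : X → X. If the sequence (f_n) has the uniform shadowing property, then f is topologically mixing. -/
open Filter Topology Set
open scoped ENNReal

variable {X : Type*}

/-- `g` is topologically mixing. -/
def TopMixing [MetricSpace X] (g : X → X) : Prop :=
  ∀ U V : Set X, IsOpen U → IsOpen V → U.Nonempty → V.Nonempty →
    ∃ N : ℕ, 1 ≤ N ∧ ∀ n ≥ N, (g^[n] '' U ∩ V).Nonempty

/-- Iterates along a convergent sequence of points converge, when the maps converge uniformly to a
continuous map. -/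
theorem TendstoUniformly.tendsto_iterate [MetricSpace X] {ι : Type*} {p : Filter ι}
    {F : ι → X → X} {f : X → X} (h : TendstoUniformly F f p) (hf : Continuous f)
    {y : ι → X} {z : X} (hy : Tendsto y p (𝓝 z)) (i : ℕ) :
    Tendsto (fun n => (F n)^[i] (y n)) p (𝓝 (f^[i] z)) := by
  induction i with
  | zero => simpa using hy
  | succ i ih =>
    simp only [Function.iterate_succ_apply']
    exact h.tendsto_comp hf.continuousAt ih

/-- The uniform limit of continuous maps with the uniform shadowing property has the shadowing
property. -/
theorem UniformShadowing.shadowingProperty_of_tendstoUniformly [MetricSpace X] [CompactSpace X]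
    {F : ℕ → X → X} {f : X → X} (hus : UniformShadowing F) (hc : ∀ n, Continuous (F n))
    (hconv : TendstoUniformly F f atTop) : ShadowingProperty f := by
  have hf : Continuous f := hconv.continuous (Eventually.of_forall hc).frequently
  intro ε hε
  obtain ⟨δ, hδ, hshadow⟩ := hus.2 (ε / 2) (half_pos hε)
  refine ⟨δ / 2, half_pos hδ, fun x hx => ?_⟩
  obtain ⟨m, hm⟩ :=
    eventually_atTop.1 (Metric.tendstoUniformly_iff.1 hconv (δ / 2) (half_pos hδ))
  have hF : ∀ n, IsPseudoOrbit (F (n + m)) δ x := fun n i => by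
    have h₁ := hm (n + m) (Nat.le_add_left m n) (x i)
    have h₂ := dist_triangle_left (F (n + m) (x i)) (x (i + 1)) (f (x i))
    have h₃ := hx i
    linarith
  choose y hy using fun n => hshadow (n + m) x (hF n)
  obtain ⟨z, φ, hφ, hz⟩ := CompactSpace.tendsto_subseq y
  have hsub : TendstoUniformly (fun n => F (φ n + m)) f atTop := fun u hu =>
    ((tendsto_add_atTop_nat m).comp hφ.tendsto_atTop).eventually (hconv u hu)
  refine ⟨z, fun i => lt_of_le_of_lt ?_ (half_lt_self hε)⟩
  exact le_of_tendsto ((hsub.tendsto_iterate hf hz i).dist tendsto_const_nhds)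
    (Eventually.of_forall fun n => (hy (φ n) i).le)

/-- The uniform limit of topologically mixing maps with the uniform shadowing property is
topologically mixing. -/
theorem stmt14 [MetricSpace X] [CompactSpace X]
    (F : ℕ → X → X) (hc : ∀ n, Continuous (F n))
    (hmix : ∀ n, TopMixing (F n))
    (f : X → X) (hconv : TendstoUniformly F f atTop)
    (hus : UniformShadowing F) :
    TopMixing f := by
  intro U V hU hV ⟨u, hu⟩ ⟨v, hv⟩
  obtain ⟨a, ha, haU⟩ := Metric.isOpen_iff.1 hU u hu
  obtain ⟨b, hb, hbV⟩ := Metric.isOpen_iff.1 hV v hv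
  obtain ⟨δ, hδ, hshadow⟩ := hus.shadowingProperty_of_tendstoUniformly hc hconv
    (min (a / 2) (b / 2)) (lt_min (half_pos ha) (half_pos hb))
  obtain ⟨m, hm⟩ := (Metric.tendstoUniformly_iff.1 hconv δ hδ).exists
  obtain ⟨N, hN, hmN⟩ := hmix m (Metric.ball u (a / 2)) (Metric.ball v (b / 2))
    Metric.isOpen_ball Metric.isOpen_ball ⟨u, Metric.mem_ball_self (half_pos ha)⟩
    ⟨v, Metric.mem_ball_self (half_pos hb)⟩
  refine ⟨N, hN, fun n hn => ?_⟩
  obtain ⟨_, ⟨x, hxu, rfl⟩, hxv⟩ := hmN n hn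
  obtain ⟨y, hy⟩ := hshadow (fun i => (F m)^[i] x) fun i => by
    simpa only [Function.iterate_succ_apply'] using hm ((F m)^[i] x)
  refine ⟨f^[n] y, mem_image_of_mem _ (haU ?_), hbV ?_⟩
  · have h₀ : dist y x < a / 2 := (hy 0).trans_le (min_le_left _ _)
    have h₁ := dist_triangle y x u
    rw [Metric.mem_ball] at hxu ⊢
    linarith
  · have h₀ : dist (f^[n] y) ((F m)^[n] x) < b / 2 := (hy n).trans_le (min_le_right _ _)
    have h₁ := dist_triangle (f^[n] y) ((F m)^[n] x) v
    rw [Metric.mem_ball] at hxv ⊢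
    linarith
end
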